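/- Let Γ be a connected simplicial graph, G a group acting on Γ by automorphisms, 𝒢 a symmetric generating set of G, and Λ an induced subgraph of Γ. Let {v_i}_{i∈I} be a set of representatives of the orbits of the G-action on the vertices of Γ. Suppose there exists a countable ordinal α such that for all g ∈ 𝒢 and all v ∈ V(Λ) one has g·v ∈ V(Λ^α), and suppose that for every i ∈ I there exists a countable ordinal β_i with v_i ∈ V(Λ^{β_i}). Then Λ is a seed subgraph of Γ, i.e. every vertex of Γ lies in V(Λ^γ) for some countable ordinal γ. -/

import Mathlib

open Ordinal

/-- `v` is uniquely determined by the nonempty set `A`: `{v} = ⋂_{w ∈ A} N(w)`. -/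
def UniqDet {V : Type*} (G : SimpleGraph V) (v : V) (A : Set V) : Prop :=
  A.Nonempty ∧ {v} = ⋂ w ∈ A, G.neighborSet w

/-- The α-th rigid expansion of the induced subgraph on the vertex set `S`. -/
noncomputable def rigidExp {V : Type*} (G : SimpleGraph V) (S : Set V) (α : Ordinal.{0}) :
    Set V :=
  Ordinal.limitRecOn α S
    (fun _ prev => prev ∪ {v | ∃ A : Set V, A ⊆ prev ∧ UniqDet G v A})
    (fun o _ ih => ⋃ β : {β : Ordinal // β < o}, ih β.1 β.2)

section RigidExpansion

variable {V : Type*} (Γ : SimpleGraph V) (S : Set V)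

theorem rigidExp_zero : rigidExp Γ S 0 = S := by
  simp [rigidExp]

theorem rigidExp_add_one (β : Ordinal) :
    rigidExp Γ S (β + 1) =
      rigidExp Γ S β ∪ {v | ∃ A : Set V, A ⊆ rigidExp Γ S β ∧ UniqDet Γ v A} := by
  simp [rigidExp]

theorem mem_rigidExp_limit {β : Ordinal} (hβ : Order.IsSuccLimit β) (v : V) :
    v ∈ rigidExp Γ S β ↔ ∃ γ < β, v ∈ rigidExp Γ S γ := by
  simp [rigidExp, limitRecOn_limit (h := hβ)]

variable {G : Type*} [Group G] [MulAction G V] {Γ S}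

theorem UniqDet.smul {g : G} (hg : ∀ u v : V, Γ.Adj (g • u) (g • v) ↔ Γ.Adj u v)
    {v : V} {A : Set V} (h : UniqDet Γ v A) : UniqDet Γ (g • v) ((g • ·) '' A) := by
  refine ⟨h.1.image _, ?_⟩
  ext x
  have hx := Set.ext_iff.1 h.2 (g⁻¹ • x)
  simp only [Set.mem_singleton_iff, Set.mem_iInter, SimpleGraph.mem_neighborSet,
    Set.forall_mem_image, inv_smul_eq_iff] at hx ⊢
  rw [hx]
  refine forall₂_congr fun w _ => ?_
  rw [← hg, smul_inv_smul]

theorem smul_mem_rigidExp_add {g : G} (hg : ∀ u v : V, Γ.Adj (g • u) (g • v) ↔ Γ.Adj u v)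
    {α : Ordinal} (h : ∀ v ∈ S, g • v ∈ rigidExp Γ S α) (β : Ordinal) :
    ∀ v ∈ rigidExp Γ S β, g • v ∈ rigidExp Γ S (α + β) := by
  induction β using Ordinal.limitRecOn with
  | zero => simpa [rigidExp_zero] using h
  | add_one β ih =>
    intro v hv
    rw [← add_assoc, rigidExp_add_one]
    rw [rigidExp_add_one] at hv
    rcases hv with hv | ⟨A, hA, hvA⟩
    · exact Or.inl (ih v hv)
    · exact Or.inr ⟨_, Set.image_subset_iff.2 fun w hw => ih w (hA hw), hvA.smul hg⟩
  | limit β hβ ih =>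
    intro v hv
    obtain ⟨γ, hγ, hv⟩ := (mem_rigidExp_limit Γ S hβ v).1 hv
    exact (mem_rigidExp_limit Γ S (isSuccLimit_add α hβ) _).2
      ⟨α + γ, by gcongr, ih γ hγ v hv⟩

end RigidExpansion

/-- Seed graph criterion: if each generator sends vertices of `Λ` into `Λ^α`, and a set of
orbit representatives of the `G`-action is contained in rigid expansions of `Λ`, then `Λ` is
a seed subgraph: every vertex of `Γ` lies in some rigid expansion `Λ^γ` with `γ` countable. -/
theorem seed_subgraph_criterion {V G : Type*} [Group G] [MulAction G V]
    (Γ : SimpleGraph V) (hconn : Γ.Connected)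
    (hact : ∀ (g : G) (u v : V), Γ.Adj (g • u) (g • v) ↔ Γ.Adj u v)
    (𝒢 : Set G) (hsymm : ∀ g ∈ 𝒢, g⁻¹ ∈ 𝒢) (hgen : Subgroup.closure 𝒢 = ⊤)
    (Λ : Set V) (α : Ordinal) (hα : α < ω_ 1)
    (hstep : ∀ g ∈ 𝒢, ∀ v ∈ Λ, g • v ∈ rigidExp Γ Λ α)
    {I : Type*} (vrep : I → V)
    (hrep : ∀ w : V, ∃ i : I, w ∈ MulAction.orbit G (vrep i))
    (hβ : ∀ i : I, ∃ β : Ordinal, β < ω_ 1 ∧ vrep i ∈ rigidExp Γ Λ β) :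
    ∀ w : V, ∃ γ : Ordinal, γ < ω_ 1 ∧ w ∈ rigidExp Γ Λ γ := by
  have hadd : ∀ β < ω_ 1, α + β < ω_ 1 := fun β hβ => isPrincipal_add_omega 1 hα hβ
  have hgood (g : G) : ∀ v, (∃ γ < ω_ 1, v ∈ rigidExp Γ Λ γ) →
      ∃ γ < ω_ 1, g • v ∈ rigidExp Γ Λ γ := by
    have hg : g ∈ Subgroup.closure 𝒢 := hgen ▸ Subgroup.mem_top g
    have hmem : ∀ g ∈ 𝒢, ∀ v, (∃ γ < ω_ 1, v ∈ rigidExp Γ Λ γ) →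
        ∃ γ < ω_ 1, g • v ∈ rigidExp Γ Λ γ := by
      rintro g hg v ⟨γ, hγ, hv⟩
      exact ⟨α + γ, hadd γ hγ, smul_mem_rigidExp_add (hact g) (hstep g hg) γ v hv⟩
    induction hg using Subgroup.closure_induction'' with
    | mem g hg => exact hmem g hg
    | inv_mem g hg => exact hmem g⁻¹ (hsymm g hg)
    | one => simp
    | mul x y _ _ hx hy =>
      intro v hv
      rw [mul_smul]
      exact hx _ (hy v hv)
  intro w
  obtain ⟨i, g, rfl⟩ := hrep w
  exact hgood g _ (hβ i)
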